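/- Let K ≥ 2. There exists a constant c_K ≥ 0, depending only on K, such that for every n ≥ 1 and every sequence x : {1,…,n} → {1,…,K} the following regret bound holds for the prequential plug-in code with the Krichevsky–Trofimov (add-1/2) estimator: ∑_{k : N_k > 0} N_k · log(N_k / n) − ∑_{i=1}^n log [ (N_{x_i}(i) + 1/2) / ((i − 1) + K/2) ] ≤ ((K − 1)/2) · log n + c_K, where N_k(i) := #{ j < i : x_j = k } and N_k := N_k(n+1). The left-hand side is the maximum log-likelihood of the sequence over all categorical distributions on K symbols minus the prequential plug-in log-likelihood; in particular the prequential plug-in distribution incurs at most O(log n) excess code length over the maximum-likelihood code length, uniformly over all sequences. -/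

import Mathlib

open scoped BigOperators

lemma kt_log_lower (n : ℝ) (hn : 0 < n) : 1 ≤ (n + 1/2) * (Real.log (n+1) - Real.log n) := by
  have h := Real.le_log_one_add_of_nonneg (x := 1/n) (by positivity)
  have e : 1 + 1/n = (n+1)/n := by field_simp
  rw [e, Real.log_div (by positivity) (by positivity)] at h
  have e2 : 2 * (1/n) / (1/n + 2) = 1/(n+1/2) := by field_simp; ring
  rw [e2, div_le_iff₀ (by positivity)] at h
  linarith

lemma kt_log_upper (n : ℝ) (hn : 0 < n) :
    (n + 1/2) * (Real.log (n+1) - Real.log n) ≤ 1 + 1/4 * (1/n - 1/(n+1)) := by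
  have hx : 1 ≤ (n+1)/n := by rw [le_div_iff₀ hn]; linarith
  have h := Real.self_le_sinh_iff.2 (Real.log_nonneg hx)
  rw [Real.sinh_log (by positivity), Real.log_div (by positivity) (by positivity)] at h
  have h2 := mul_le_mul_of_nonneg_left h (by positivity : 0 ≤ n + 1/2)
  refine h2.trans (le_of_eq ?_)
  field_simp
  ring

lemma kt_mid_lower (n : ℝ) (hn : 0 < n) :
    1/2 * (Real.log (n+1) + Real.log n) ≤ Real.log (n+1/2) := by
  have h : Real.log ((n+1)*n) ≤ Real.log ((n+1/2)^2) :=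
    Real.log_le_log (by positivity) (by nlinarith)
  rw [Real.log_mul (by positivity) (by positivity), Real.log_pow] at h
  push_cast at h
  linarith

lemma kt_mid_upper (n : ℝ) (hn : 0 < n) :
    Real.log (n+1/2) ≤ 1/2 * (Real.log (n+1) + Real.log n) + 1/8 * (1/n - 1/(n+1)) := by
  have h := Real.log_le_sub_one_of_pos (x := (n+1/2)^2/((n+1)*n)) (by positivity)
  rw [Real.log_div (by positivity) (by positivity),
    Real.log_mul (by positivity) (by positivity), Real.log_pow] at h
  have e : (n+1/2)^2/((n+1)*n) - 1 = 1/4 * (1/n - 1/(n+1)) := by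
    field_simp; ring
  rw [e] at h
  push_cast at h
  linarith

lemma kt_log_half : -1 ≤ Real.log (1/2 : ℝ) ∧ Real.log (1/2 : ℝ) ≤ 0 := by
  constructor
  · have := Real.one_sub_inv_le_log_of_pos (x := (1/2:ℝ)) (by norm_num)
    norm_num at this ⊢
    linarith
  · exact Real.log_nonpos (by norm_num) (by norm_num)

lemma kt_A (m : ℕ) : (m+1 : ℝ) * Real.log (m+1)
    - ∑ j ∈ Finset.range (m+1), Real.log ((j:ℝ)+1/2) ≤ (m+1) + 1 - 1/4 * (1/((m:ℝ)+1)) := by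
  induction m with
  | zero => have := kt_log_half.1; norm_num at this ⊢; linarith
  | succ m ih =>
    rw [Finset.sum_range_succ]
    have h1 := kt_log_upper (m+1) (by positivity)
    have h2 := kt_mid_lower (m+1) (by positivity)
    push_cast at *
    linarith

lemma kt_A' (m : ℕ) : (m : ℝ) * Real.log m
    - ∑ j ∈ Finset.range m, Real.log ((j:ℝ)+1/2) ≤ m + 1 := by
  cases m with
  | zero => simp
  | succ m =>
    have := kt_A m
    have h : (0:ℝ) ≤ 1/((m:ℝ)+1) := by positivity
    push_cast at *
    linarith

lemma kt_B (K : ℝ) (hK : 1 ≤ K) (m : ℕ) :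
    ∑ j ∈ Finset.range (m+1), Real.log ((j:ℝ)+K/2) ≤
      (m+1 : ℝ) * Real.log (m+1) - (m+1) + (K-1)/2 * Real.log (m+1) + (K + 2)
        - 1/8 * (1/((m:ℝ)+1)) := by
  induction m with
  | zero =>
    have := Real.log_le_sub_one_of_pos (x := K/2) (by positivity)
    norm_num at this ⊢; linarith
  | succ m ih =>
    rw [Finset.sum_range_succ]
    have hn : (0:ℝ) < m+1 := by positivity
    generalize hS : ∑ j ∈ Finset.range (m+1), Real.log ((j:ℝ)+K/2) = S at *
    push_cast at *
    generalize (m:ℝ)+1 = n at *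
    have h1 := kt_log_lower n hn
    have h2 := kt_mid_upper n hn
    have h3 : Real.log (n + K/2) ≤ Real.log (n+1/2) + (K-1)/2 * (1/(n+1/2)) := by
      have h := Real.log_le_sub_one_of_pos (x := (n+K/2)/(n+1/2)) (by positivity)
      rw [Real.log_div (by positivity) (by positivity)] at h
      have e : (n+K/2)/(n+1/2) - 1 = (K-1)/2 * (1/(n+1/2)) := by field_simp; ring
      linarith
    have h4 : 1/(n+1/2) ≤ Real.log (n+1) - Real.log n := by
      rw [div_le_iff₀ (by positivity)]; linarith
    have h5 := mul_le_mul_of_nonneg_left h4 (by linarith : 0 ≤ (K-1)/2)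
    linarith

lemma kt_regroup {n K : ℕ} (x : Fin n → Fin K) (N : Fin K → ℕ → ℕ)
    (hN : ∀ k m, N k m
            = (Finset.univ.filter fun j : Fin n => (j : ℕ) < m ∧ x j = k).card)
    (f : ℕ → ℝ) (m : ℕ) (hm : m ≤ n) :
    ∑ i ∈ Finset.univ.filter (fun i : Fin n => (i:ℕ) < m), f (N (x i) i)
      = ∑ k, ∑ j ∈ Finset.range (N k m), f j := by
  induction m with
  | zero => simp [hN]
  | succ m ih =>
    have hf : Finset.univ.filter (fun i : Fin n => (i:ℕ) < m+1)
        = insert ⟨m, hm⟩ (Finset.univ.filter (fun i : Fin n => (i:ℕ) < m)) := by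
      ext i; simp [Fin.ext_iff]; omega
    have hs : ∀ k, N k (m+1) = N k m + if x ⟨m, hm⟩ = k then 1 else 0 := by
      intro k
      rw [hN, hN]
      split_ifs with h
      · rw [← Finset.card_insert_of_notMem (a := (⟨m, hm⟩ : Fin n)) (by simp)]
        congr 1
        ext i
        simp only [Finset.mem_filter, Finset.mem_univ, true_and, Finset.mem_insert]
        constructor
        · rintro ⟨h1, h2⟩
          by_cases hi : (i:ℕ) = m
          · left; exact Fin.ext hi
          · right; exact ⟨by omega, h2⟩
        · rintro (rfl | ⟨h1, h2⟩)
          · exact ⟨by simp, h⟩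
          · exact ⟨by omega, h2⟩
      · rw [add_zero]
        congr 1
        ext i
        simp only [Finset.mem_filter, Finset.mem_univ, true_and]
        constructor
        · rintro ⟨h1, h2⟩
          refine ⟨?_, h2⟩
          by_contra hc
          have : i = ⟨m, hm⟩ := Fin.ext (by simp; omega)
          exact h (this ▸ h2)
        · rintro ⟨h1, h2⟩
          exact ⟨by omega, h2⟩
    rw [hf, Finset.sum_insert (by simp), ih (by omega)]
    have : ∀ k, ∑ j ∈ Finset.range (N k (m+1)), f j
        = ∑ j ∈ Finset.range (N k m), f j + if x ⟨m, hm⟩ = k then f (N k m) else 0 := by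
      intro k
      rw [hs]
      split_ifs
      · rw [Finset.sum_range_succ]
      · simp
    simp only [this, Finset.sum_add_distrib, Finset.sum_ite_eq, Finset.mem_univ, if_true]
    ring

/-- **Uniform O(log n) regret of the Krichevsky–Trofimov prequential plug-in code.**
For the class of categorical distributions on `K ≥ 2` symbols, there is a constant
`c ≥ 0` depending only on `K` such that for every `n ≥ 1` and every sequence
`x : Fin n → Fin K` (with prefix counts `N k i = #{j < i : x j = k}`, `i : Fin n`
0-based so `(i : ℝ)` plays the role of `i − 1`, and total counts `N k n`), the
maximum log-likelihood `∑_{k : N_k > 0} N_k log(N_k/n)` exceeds the prequential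
plug-in log-likelihood `∑_i log((N_{x_i}(i) + 1/2)/((i−1) + K/2))` by at most
`((K−1)/2) log n + c`. -/
theorem kt_prequential_regret_bound (K : ℕ) (hK : 2 ≤ K) :
    ∃ c : ℝ, 0 ≤ c ∧
      ∀ (n : ℕ), 1 ≤ n → ∀ x : Fin n → Fin K,
        ∀ N : Fin K → ℕ → ℕ,
          (∀ k m, N k m
            = (Finset.univ.filter fun j : Fin n => (j : ℕ) < m ∧ x j = k).card) →
          (∑ k ∈ Finset.univ.filter (fun k : Fin K => 0 < N k n),
              (N k n : ℝ) * Real.log ((N k n : ℝ) / n))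
            - (∑ i : Fin n,
                Real.log (((N (x i) i : ℝ) + 1 / 2) / ((i : ℝ) + K / 2)))
          ≤ ((K : ℝ) - 1) / 2 * Real.log n + c := by
  have hK' : (2:ℝ) ≤ K := by exact_mod_cast hK
  refine ⟨2 * K + 2, by positivity, ?_⟩
  intro n hn x N hN
  have hn0 : (0:ℝ) < n := by exact_mod_cast hn
  have hreg : ∀ f : ℕ → ℝ, ∑ i : Fin n, f (N (x i) i)
      = ∑ k, ∑ j ∈ Finset.range (N k n), f j := by
    intro f
    rw [← kt_regroup x N hN f n le_rfl]
    simp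
  have hsum : ∑ k, (N k n : ℝ) = n := by
    have := hreg (fun _ => 1)
    simp at this
    exact this.symm
  have h1 : ∑ k ∈ Finset.univ.filter (fun k : Fin K => 0 < N k n),
      (N k n : ℝ) * Real.log ((N k n : ℝ) / n)
      = ∑ k, (N k n : ℝ) * Real.log (N k n) - n * Real.log n := by
    rw [← hsum, Finset.sum_mul, ← Finset.sum_sub_distrib, Finset.sum_filter, hsum]
    refine Finset.sum_congr rfl fun k _ => ?_
    split_ifs with h
    · have : (0:ℝ) < N k n := by exact_mod_cast h
      rw [Real.log_div this.ne' hn0.ne']; ring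
    · have : N k n = 0 := by omega
      simp [this]
  have h2 : ∑ i : Fin n, Real.log (((N (x i) i : ℝ) + 1 / 2) / ((i : ℝ) + K / 2))
      = ∑ k, ∑ j ∈ Finset.range (N k n), Real.log ((j:ℝ) + 1/2)
        - ∑ j ∈ Finset.range n, Real.log ((j:ℝ) + K/2) := by
    rw [← hreg (fun j => Real.log ((j:ℝ) + 1/2)),
      ← Fin.sum_univ_eq_sum_range (fun j => Real.log ((j:ℝ) + K/2)), ← Finset.sum_sub_distrib]
    refine Finset.sum_congr rfl fun i _ => ?_
    rw [Real.log_div (by positivity) (by positivity)]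
  have h3 : ∑ k, ((N k n : ℝ) * Real.log (N k n)
      - ∑ j ∈ Finset.range (N k n), Real.log ((j:ℝ) + 1/2)) ≤ ∑ k, ((N k n : ℝ) + 1) :=
    Finset.sum_le_sum fun k _ => kt_A' (N k n)
  rw [Finset.sum_sub_distrib, Finset.sum_add_distrib, hsum] at h3
  simp only [Finset.sum_const, Finset.card_univ, Fintype.card_fin, nsmul_eq_mul, mul_one] at h3
  obtain ⟨m, rfl⟩ : ∃ m, n = m + 1 := ⟨n - 1, by omega⟩
  have h4 := kt_B K (by linarith) m
  have h5 : (0:ℝ) ≤ 1/((m:ℝ)+1) := by positivity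
  rw [h1, h2]
  push_cast at *
  linarith
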